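/- arXiv:1104.0960 — 3 statements merged into one kernel-verified Lean document; each statement's English description precedes it below -/
import Mathlib

section
/- Let c < d be real numbers and let u : [c,d] → ℝ be continuously differentiable with u′ differentiable on (c,d) and second derivative u″ square integrable on (c,d). Let ℓ be the affine function with ℓ(c) = u(c) and ℓ(d) = u(d). Then ∫_c^d ((u−ℓ)′(x))² dx ≤ (d−c)² ∫_c^d (u″(x))² dx. Consequently, if a : (c,d) → ℝ is measurable with 0 < α ≤ a(x) ≤ β a.e., then ∫_c^d a(x)((u−ℓ)′(x))² dx ≤ β (d−c)² ∫_c^d (u″(x))² dx. -/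
open MeasureTheory

/-- Cauchy-Schwarz against the constant function on an interval. -/
theorem sq_intervalIntegral_le {f : ℝ → ℝ} {p q : ℝ} (hpq : p ≤ q)
    (hf : IntervalIntegrable f volume p q)
    (hf2 : IntervalIntegrable (fun x => f x ^ 2) volume p q) :
    (∫ x in p..q, f x) ^ 2 ≤ (q - p) * ∫ x in p..q, f x ^ 2 := by
  rcases hpq.eq_or_lt with rfl | hlt
  · simp
  set D := ∫ x in p..q, f x with hD
  have hnonneg : 0 ≤ ∫ x in p..q, ((q - p) * f x - D) ^ 2 :=
    intervalIntegral.integral_nonneg hpq fun x _ => sq_nonneg _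
  have hexpand : ∫ x in p..q, ((q - p) * f x - D) ^ 2
      = (q - p) * ((q - p) * (∫ x in p..q, f x ^ 2) - D ^ 2) := by
    have hpt : ∀ x, ((q - p) * f x - D) ^ 2
        = (q - p) ^ 2 * f x ^ 2 - 2 * (q - p) * D * f x + D ^ 2 := fun x => by ring
    simp_rw [hpt]
    rw [intervalIntegral.integral_add ((hf2.const_mul _).sub (hf.const_mul _))
        intervalIntegrable_const,
      intervalIntegral.integral_sub (hf2.const_mul _) (hf.const_mul _),
      intervalIntegral.integral_const_mul, intervalIntegral.integral_const_mul,
      intervalIntegral.integral_const, ← hD, smul_eq_mul]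
    ring
  rw [hexpand] at hnonneg
  linarith [nonneg_of_mul_nonneg_right hnonneg (sub_pos.2 hlt)]

/-- A function with square integrable derivative on a bounded open interval has oscillation
controlled by the `L²` norm of its derivative. -/
theorem sq_sub_le_of_hasDerivAt_of_integrableOn_sq {g f : ℝ → ℝ} {c d : ℝ}
    (hg : ∀ x ∈ Set.Ioo c d, HasDerivAt g (f x) x)
    (hf2 : IntegrableOn (fun x => f x ^ 2) (Set.Ioo c d))
    {x y : ℝ} (hx : x ∈ Set.Ioo c d) (hy : y ∈ Set.Ioo c d) :
    (g x - g y) ^ 2 ≤ (d - c) * ∫ t in Set.Ioo c d, f t ^ 2 := by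
  wlog hyx : y ≤ x generalizing x y
  · rw [sub_sq_comm]
    exact this hy hx (le_of_not_ge hyx)
  have hmeas : AEStronglyMeasurable f (volume.restrict (Set.Ioo c d)) := by
    refine (measurable_deriv g).aestronglyMeasurable.congr ?_
    filter_upwards [ae_restrict_mem measurableSet_Ioo] with t ht using (hg t ht).deriv
  have hf : IntegrableOn f (Set.Ioo c d) :=
    ((memLp_two_iff_integrable_sq hmeas).2 hf2).integrable one_le_two
  have hIcc : Set.Icc y x ⊆ Set.Ioo c d := Set.Icc_subset_Ioo hy.1 hx.2
  have hIoc : Set.Ioc y x ⊆ Set.Ioo c d := Set.Ioc_subset_Icc_self.trans hIcc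
  have hfi : IntervalIntegrable f volume y x :=
    (intervalIntegrable_iff_integrableOn_Ioc_of_le hyx).2 (hf.mono_set hIoc)
  have hfi2 : IntervalIntegrable (fun t => f t ^ 2) volume y x :=
    (intervalIntegrable_iff_integrableOn_Ioc_of_le hyx).2 (hf2.mono_set hIoc)
  have hftc : ∫ t in y..x, f t = g x - g y :=
    intervalIntegral.integral_eq_sub_of_hasDerivAt
      (fun t ht => hg t (hIcc (Set.uIcc_of_le hyx ▸ ht))) hfi
  have hmono : ∫ t in y..x, f t ^ 2 ≤ ∫ t in Set.Ioo c d, f t ^ 2 := by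
    rw [intervalIntegral.integral_of_le hyx]
    exact setIntegral_mono_set hf2 (Filter.Eventually.of_forall fun t => sq_nonneg _)
      hIoc.eventuallyLE
  rw [← hftc]
  refine (sq_intervalIntegral_le hyx hfi hfi2).trans ?_
  have hnonneg : 0 ≤ ∫ t in y..x, f t ^ 2 :=
    intervalIntegral.integral_nonneg hyx fun t _ => sq_nonneg _
  exact mul_le_mul (by linarith [hx.2, hy.1]) hmono hnonneg (by linarith [hx.1, hx.2])

theorem stmt4
    (c d : ℝ) (hcd : c < d)
    (u u' u'' : ℝ → ℝ)
    -- u is continuously differentiable on [c,d] with derivative u′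
    (hu_deriv : ∀ x ∈ Set.Icc c d, HasDerivWithinAt u (u' x) (Set.Icc c d) x)
    (hu'_cont : ContinuousOn u' (Set.Icc c d))
    -- u′ is differentiable on (c,d) with second derivative u″
    (hu''_deriv : ∀ x ∈ Set.Ioo c d, HasDerivAt u' (u'' x) x)
    -- u″ is square integrable on (c,d)
    (hu''_sq : IntegrableOn (fun x => (u'' x) ^ 2) (Set.Ioo c d))
    -- ℓ is the affine function with ℓ(c) = u(c), ℓ(d) = u(d)
    (ℓ : ℝ → ℝ)
    (hℓ : ∀ x, ℓ x = u c + (u d - u c) / (d - c) * (x - c)) :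
    -- ∫_c^d ((u−ℓ)′)² ≤ (d − c)² ∫_c^d (u″)²
    ((∫ x in Set.Ioo c d, (u' x - (u d - u c) / (d - c)) ^ 2)
        ≤ (d - c) ^ 2 * ∫ x in Set.Ioo c d, (u'' x) ^ 2) ∧
    -- consequently, for measurable a with 0 < α ≤ a ≤ β a.e.:
    -- ∫_c^d a ((u−ℓ)′)² ≤ β (d − c)² ∫_c^d (u″)²
    (∀ (a : ℝ → ℝ) (α β : ℝ), 0 < α → α ≤ β → Measurable a →
      (∀ᵐ x ∂(volume.restrict (Set.Ioo c d)), α ≤ a x ∧ a x ≤ β) →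
      (∫ x in Set.Ioo c d, a x * (u' x - (u d - u c) / (d - c)) ^ 2)
        ≤ β * (d - c) ^ 2 * ∫ x in Set.Ioo c d, (u'' x) ^ 2) := by
  obtain ⟨ξ, hξ, hslope⟩ := exists_hasDerivAt_eq_slope u u' hcd
    (fun x hx => (hu_deriv x hx).continuousWithinAt)
    (fun x hx => (hu_deriv x (Set.Ioo_subset_Icc_self hx)).hasDerivAt (Icc_mem_nhds hx.1 hx.2))
  rw [← hslope]
  have hint : IntegrableOn (fun x => (u' x - u' ξ) ^ 2) (Set.Ioo c d) :=
    (((hu'_cont.sub continuousOn_const).pow 2).integrableOn_Icc).mono_set Set.Ioo_subset_Icc_self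
  have hbound : (∫ x in Set.Ioo c d, (u' x - u' ξ) ^ 2)
      ≤ (d - c) ^ 2 * ∫ x in Set.Ioo c d, (u'' x) ^ 2 := by
    calc (∫ x in Set.Ioo c d, (u' x - u' ξ) ^ 2)
        ≤ ∫ _ in Set.Ioo c d, (d - c) * ∫ x in Set.Ioo c d, (u'' x) ^ 2 :=
          setIntegral_mono_on hint (integrableOn_const measure_Ioo_lt_top.ne) measurableSet_Ioo
            fun x hx => sq_sub_le_of_hasDerivAt_of_integrableOn_sq hu''_deriv hu''_sq hx hξ
      _ = (d - c) ^ 2 * ∫ x in Set.Ioo c d, (u'' x) ^ 2 := by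
          rw [setIntegral_const, Real.volume_real_Ioo_of_le hcd.le, smul_eq_mul]
          ring
  refine ⟨hbound, fun a α β hα hαβ _ ha => ?_⟩
  calc (∫ x in Set.Ioo c d, a x * (u' x - u' ξ) ^ 2)
      ≤ ∫ x in Set.Ioo c d, β * (u' x - u' ξ) ^ 2 := by
        refine integral_mono_of_nonneg ?_ (hint.const_mul β) ?_
        · filter_upwards [ha] with x hx using mul_nonneg (hα.le.trans hx.1) (sq_nonneg _)
        · filter_upwards [ha] with x hx using mul_le_mul_of_nonneg_right hx.2 (sq_nonneg _)
    _ = β * ∫ x in Set.Ioo c d, (u' x - u' ξ) ^ 2 := integral_const_mul _ _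
    _ ≤ β * ((d - c) ^ 2 * ∫ x in Set.Ioo c d, (u'' x) ^ 2) :=
        mul_le_mul_of_nonneg_left hbound (hα.le.trans hαβ)
    _ = β * (d - c) ^ 2 * ∫ x in Set.Ioo c d, (u'' x) ^ 2 := by ring
end

section
/- Let V be a real vector space and let B and B₀ be symmetric bilinear forms on V such that B₀(v,v) ≥ 0 for all v and α B₀(v,v) ≤ B(v,v) ≤ β B₀(v,v) for all v ∈ V, where 0 < α ≤ β. If v₁, v₂ ∈ V satisfy B₀(v₁,v₂) = 0, then (α/β)·(B(v₁,v₁) + B(v₂,v₂)) ≤ B(v₁+v₂, v₁+v₂) ≤ (β/α)·(B(v₁,v₁) + B(v₂,v₂)). -/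
theorem stmt6
    (V : Type*) [AddCommGroup V] [Module ℝ V]
    (B B₀ : LinearMap.BilinForm ℝ V)
    (hB_symm : B.IsSymm) (hB₀_symm : B₀.IsSymm)
    (α β : ℝ) (hα : 0 < α) (hαβ : α ≤ β)
    -- B₀ is positive semidefinite
    (hB₀_pos : ∀ v : V, 0 ≤ B₀ v v)
    -- α B₀(v,v) ≤ B(v,v) ≤ β B₀(v,v) for all v
    (hsandwich : ∀ v : V, α * B₀ v v ≤ B v v ∧ B v v ≤ β * B₀ v v)
    (v₁ v₂ : V) (horth : B₀ v₁ v₂ = 0) :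
    (α / β) * (B v₁ v₁ + B v₂ v₂) ≤ B (v₁ + v₂) (v₁ + v₂) ∧
      B (v₁ + v₂) (v₁ + v₂) ≤ (β / α) * (B v₁ v₁ + B v₂ v₂) := by
  have hβ : 0 < β := hα.trans_le hαβ
  have pythagoras : B₀ (v₁ + v₂) (v₁ + v₂) = B₀ v₁ v₁ + B₀ v₂ v₂ := by
    have horth' : B₀ v₂ v₁ = 0 := (hB₀_symm.eq v₂ v₁).trans horth
    simp [horth, horth']
  obtain ⟨lower₁, upper₁⟩ := hsandwich v₁
  obtain ⟨lower₂, upper₂⟩ := hsandwich v₂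
  obtain ⟨lower, upper⟩ := hsandwich (v₁ + v₂)
  rw [pythagoras] at lower upper
  constructor
  · rw [div_mul_eq_mul_div, div_le_iff₀ hβ]
    calc α * (B v₁ v₁ + B v₂ v₂) ≤ α * (β * (B₀ v₁ v₁ + B₀ v₂ v₂)) := by
          gcongr; linarith
      _ = α * (B₀ v₁ v₁ + B₀ v₂ v₂) * β := by ring
      _ ≤ B (v₁ + v₂) (v₁ + v₂) * β := by gcongr
  · rw [div_mul_eq_mul_div, le_div_iff₀ hα]
    calc B (v₁ + v₂) (v₁ + v₂) * α ≤ β * (B₀ v₁ v₁ + B₀ v₂ v₂) * α := by gcongr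
      _ = β * (α * (B₀ v₁ v₁ + B₀ v₂ v₂)) := by ring
      _ ≤ β * (B v₁ v₁ + B v₂ v₂) := by gcongr; linarith
end

section
/- Let A = [[A₁₁, A₁₂],[A₁₂ᵀ, A₂₂]] be a symmetric positive definite (n₁+n₂)×(n₁+n₂) real matrix, and suppose there are 0 < L₁ ≤ U₁ with L₁(ξᵀA₁₁ξ + ηᵀA₂₂η) ≤ xᵀAx ≤ U₁(ξᵀA₁₁ξ + ηᵀA₂₂η) for all x = (ξᵀ,ηᵀ)ᵀ ∈ ℝ^{n₁+n₂}. Then the scaled condition numbers satisfy 𝔎(A) ≥ (L₁/U₁) · 𝔎(A₁₁). -/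
open Matrix

/-- The smallest eigenvalue of a (symmetric) real matrix, as the infimum of its spectrum. -/
noncomputable def specMin {m : Type*} [Fintype m] [DecidableEq m]
    (M : Matrix m m ℝ) : ℝ :=
  sInf {μ : ℝ | Module.End.HasEigenvalue (Matrix.toLin' M) μ}

/-- The largest eigenvalue of a (symmetric) real matrix, as the supremum of its spectrum. -/
noncomputable def specMax {m : Type*} [Fintype m] [DecidableEq m]
    (M : Matrix m m ℝ) : ℝ :=
  sSup {μ : ℝ | Module.End.HasEigenvalue (Matrix.toLin' M) μ}

/-- The diagonal scaling `D_M` with `(D_M)ᵢᵢ = (Mᵢᵢ)^{-1/2}`. -/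
noncomputable def diagScale {m : Type*} [Fintype m] [DecidableEq m]
    (M : Matrix m m ℝ) : Matrix m m ℝ :=
  Matrix.diagonal fun i => (Real.sqrt (M i i))⁻¹

/-- The scaled condition number `𝔎(M) = λ_max(D_M M D_M) / λ_min(D_M M D_M)`. -/
noncomputable def scaledCond {m : Type*} [Fintype m] [DecidableEq m]
    (M : Matrix m m ℝ) : ℝ :=
  specMax (diagScale M * M * diagScale M) / specMin (diagScale M * M * diagScale M)

open scoped MatrixOrder in
theorem Matrix.IsHermitian.le_spectrum_submatrix {m n : Type*} [Fintype m] [DecidableEq m]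
    [Fintype n] [DecidableEq n] {M : Matrix m m ℝ} (hM : M.IsHermitian) {f : n → m}
    (hf : Function.Injective f) {c : ℝ} (hc : ∀ x ∈ spectrum ℝ M, c ≤ x) :
    ∀ x ∈ spectrum ℝ (M.submatrix f f), c ≤ x := by
  have h := (algebraMap_le_iff_le_spectrum (a := M) (r := c) hM).2 hc
  refine (algebraMap_le_iff_le_spectrum (a := M.submatrix f f) (r := c) (hM.submatrix f)).1 ?_
  rw [Matrix.le_iff] at h ⊢
  convert h.submatrix f using 1
  ext i j
  simp [Matrix.algebraMap_matrix_apply, hf.eq_iff]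

open scoped MatrixOrder in
theorem Matrix.IsHermitian.spectrum_submatrix_le {m n : Type*} [Fintype m] [DecidableEq m]
    [Fintype n] [DecidableEq n] {M : Matrix m m ℝ} (hM : M.IsHermitian) {f : n → m}
    (hf : Function.Injective f) {c : ℝ} (hc : ∀ x ∈ spectrum ℝ M, x ≤ c) :
    ∀ x ∈ spectrum ℝ (M.submatrix f f), x ≤ c := by
  have h := (le_algebraMap_iff_spectrum_le (a := M) (r := c) hM).2 hc
  refine (le_algebraMap_iff_spectrum_le (a := M.submatrix f f) (r := c) (hM.submatrix f)).1 ?_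
  rw [Matrix.le_iff] at h ⊢
  convert h.submatrix f using 1
  ext i j
  simp [Matrix.algebraMap_matrix_apply, hf.eq_iff]

theorem setOf_hasEigenvalue_eq_spectrum {m : Type*} [Fintype m] [DecidableEq m]
    (M : Matrix m m ℝ) :
    {μ : ℝ | Module.End.HasEigenvalue (Matrix.toLin' M) μ} = spectrum ℝ M := by
  ext μ
  rw [Set.mem_ofPred_eq, Module.End.hasEigenvalue_iff_mem_spectrum, Matrix.spectrum_toLin']

theorem specMin_eq_sInf_spectrum {m : Type*} [Fintype m] [DecidableEq m]
    (M : Matrix m m ℝ) : specMin M = sInf (spectrum ℝ M) := by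
  rw [specMin, setOf_hasEigenvalue_eq_spectrum]

theorem specMax_eq_sSup_spectrum {m : Type*} [Fintype m] [DecidableEq m]
    (M : Matrix m m ℝ) : specMax M = sSup (spectrum ℝ M) := by
  rw [specMax, setOf_hasEigenvalue_eq_spectrum]

theorem Matrix.IsHermitian.spectrum_real_nonempty {m : Type*} [Fintype m] [DecidableEq m]
    [Nonempty m] {M : Matrix m m ℝ} (hM : M.IsHermitian) : (spectrum ℝ M).Nonempty := by
  rw [hM.spectrum_real_eq_range_eigenvalues]
  exact Set.range_nonempty _

theorem Matrix.PosDef.pos_of_mem_spectrum {m : Type*} [Fintype m] [DecidableEq m]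
    {M : Matrix m m ℝ} (hM : M.PosDef) {x : ℝ} (hx : x ∈ spectrum ℝ M) : 0 < x := by
  rw [hM.isHermitian.spectrum_real_eq_range_eigenvalues] at hx
  obtain ⟨i, rfl⟩ := hx
  exact hM.eigenvalues_pos i

theorem Matrix.PosDef.specMin_pos {m : Type*} [Fintype m] [DecidableEq m] [Nonempty m]
    {M : Matrix m m ℝ} (hM : M.PosDef) : 0 < specMin M := by
  rw [specMin_eq_sInf_spectrum]
  exact hM.pos_of_mem_spectrum
    (hM.isHermitian.spectrum_real_nonempty.csInf_mem M.finite_real_spectrum)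

theorem Matrix.PosDef.specMax_nonneg {m : Type*} [Fintype m] [DecidableEq m]
    {M : Matrix m m ℝ} (hM : M.PosDef) : 0 ≤ specMax M := by
  rw [specMax_eq_sSup_spectrum]
  exact Real.sSup_nonneg fun x hx => (hM.pos_of_mem_spectrum hx).le

theorem Matrix.PosDef.specMin_nonneg {m : Type*} [Fintype m] [DecidableEq m]
    {M : Matrix m m ℝ} (hM : M.PosDef) : 0 ≤ specMin M := by
  rw [specMin_eq_sInf_spectrum]
  exact Real.sInf_nonneg fun x hx => (hM.pos_of_mem_spectrum hx).le

/-- Passing to a principal submatrix does not increase the condition number. -/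
theorem Matrix.PosDef.specMax_div_specMin_submatrix_le {m n : Type*} [Fintype m] [DecidableEq m]
    [Fintype n] [DecidableEq n] {M : Matrix m m ℝ} (hM : M.PosDef) {f : n → m}
    (hf : Function.Injective f) :
    specMax (M.submatrix f f) / specMin (M.submatrix f f) ≤ specMax M / specMin M := by
  rcases isEmpty_or_nonempty n with hn | hn
  · have h : specMax (M.submatrix f f) = 0 := by
      rw [specMax_eq_sSup_spectrum, spectrum.of_subsingleton, Real.sSup_empty]
    rw [h, zero_div]
    exact div_nonneg hM.specMax_nonneg hM.specMin_nonneg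
  · have : Nonempty m := hn.map f
    have hne := (hM.isHermitian.submatrix f).spectrum_real_nonempty
    refine div_le_div₀ hM.specMax_nonneg ?_ hM.specMin_pos ?_
    · rw [specMax_eq_sSup_spectrum, specMax_eq_sSup_spectrum]
      exact csSup_le hne (hM.isHermitian.spectrum_submatrix_le hf
        fun x hx => le_csSup M.finite_real_spectrum.bddAbove hx)
    · rw [specMin_eq_sInf_spectrum, specMin_eq_sInf_spectrum]
      exact le_csInf hne (hM.isHermitian.le_spectrum_submatrix hf
        fun x hx => csInf_le M.finite_real_spectrum.bddBelow hx)

theorem Matrix.PosDef.diagScale_mul_mul {m : Type*} [Fintype m] [DecidableEq m]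
    {M : Matrix m m ℝ} (hM : M.PosDef) : (diagScale M * M * diagScale M).PosDef := by
  have hu : IsUnit (diagScale M) := by
    rw [diagScale, Matrix.isUnit_diagonal, Pi.isUnit_iff]
    exact fun i => (inv_ne_zero (Real.sqrt_pos.2 (hM.diag_pos (i := i))).ne').isUnit
  have h := hM.conjTranspose_mul_mul_same (B := diagScale M) (Matrix.mulVec_injective_of_isUnit hu)
  rwa [show (diagScale M)ᴴ = diagScale M by simp [diagScale]] at h

theorem diagScale_mul_mul_submatrix {m n : Type*} [Fintype m] [DecidableEq m]
    [Fintype n] [DecidableEq n] (M : Matrix m m ℝ) (f : n → m) :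
    diagScale (M.submatrix f f) * M.submatrix f f * diagScale (M.submatrix f f) =
      (diagScale M * M * diagScale M).submatrix f f := by
  ext i j
  simp [diagScale]

/-- Passing to a principal submatrix does not increase the scaled condition number. -/
theorem Matrix.PosDef.scaledCond_submatrix_le {m n : Type*} [Fintype m] [DecidableEq m]
    [Fintype n] [DecidableEq n] {M : Matrix m m ℝ} (hM : M.PosDef) {f : n → m}
    (hf : Function.Injective f) : scaledCond (M.submatrix f f) ≤ scaledCond M := by
  rw [scaledCond, diagScale_mul_mul_submatrix]
  exact hM.diagScale_mul_mul.specMax_div_specMin_submatrix_le hf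

theorem Matrix.PosDef.scaledCond_nonneg {m : Type*} [Fintype m] [DecidableEq m]
    {M : Matrix m m ℝ} (hM : M.PosDef) : 0 ≤ scaledCond M :=
  div_nonneg hM.diagScale_mul_mul.specMax_nonneg hM.diagScale_mul_mul.specMin_nonneg

theorem stmt14
    (n₁ n₂ : ℕ)
    (A₁₁ : Matrix (Fin n₁) (Fin n₁) ℝ) (A₂₂ : Matrix (Fin n₂) (Fin n₂) ℝ)
    (A₁₂ : Matrix (Fin n₁) (Fin n₂) ℝ)
    (A : Matrix (Fin n₁ ⊕ Fin n₂) (Fin n₁ ⊕ Fin n₂) ℝ)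
    (hA : A = Matrix.fromBlocks A₁₁ A₁₂ A₁₂ᵀ A₂₂)
    -- A is symmetric positive definite
    (hA_pd : A.PosDef)
    -- almost orthogonality (Assumption 1)
    (L₁ U₁ : ℝ) (hL₁ : 0 < L₁) (hL₁U₁ : L₁ ≤ U₁)
    (hblock : ∀ (ξ : Fin n₁ → ℝ) (η : Fin n₂ → ℝ),
      L₁ * (ξ ⬝ᵥ A₁₁ *ᵥ ξ + η ⬝ᵥ A₂₂ *ᵥ η)
          ≤ (Sum.elim ξ η) ⬝ᵥ A *ᵥ (Sum.elim ξ η) ∧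
        (Sum.elim ξ η) ⬝ᵥ A *ᵥ (Sum.elim ξ η)
          ≤ U₁ * (ξ ⬝ᵥ A₁₁ *ᵥ ξ + η ⬝ᵥ A₂₂ *ᵥ η)) :
    (L₁ / U₁) * scaledCond A₁₁ ≤ scaledCond A := by
  have hsub : A.submatrix Sum.inl Sum.inl = A₁₁ := by
    rw [hA]
    rfl
  have hle : scaledCond A₁₁ ≤ scaledCond A :=
    hsub ▸ hA_pd.scaledCond_submatrix_le Sum.inl_injective
  have hnonneg : 0 ≤ scaledCond A₁₁ :=
    (hsub ▸ hA_pd.submatrix Sum.inl_injective : A₁₁.PosDef).scaledCond_nonneg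
  exact (mul_le_of_le_one_left hnonneg (div_le_one_of_le₀ hL₁U₁ (hL₁.le.trans hL₁U₁))).trans hle
end
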